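/- Let (V, {f_{il}}) be a weak lower perfect space over k with a lower perfect basis B. Then p_H(B_H) is a k-basis of V_H. -/

import Mathlib

open Function

/-- A weak lower perfect space: a `P`-graded `k`-vector space `V = ⊕_{μ ∈ P} V_μ`
with endomorphisms `f il` for `(i,l) ∈ I^∞ = I × ℤ_{>0}`. -/
structure WeakLowerPerfectSpace (k I P V : Type*) [Field k] [AddCommGroup P]
    [AddCommGroup V] [Module k V] where
  /-- the simple roots `α_i` -/
  alpha : I → P
  alpha_indep : LinearIndependent ℤ alpha
  /-- `P` is a free abelian group -/
  free : Module.Free ℤ P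
  /-- the weight spaces `V_μ` -/
  weight : P → Submodule k V
  weight_indep : iSupIndep weight
  weight_sup : ⨆ μ : P, weight μ = ⊤
  /-- the endomorphisms `f_{il}` -/
  f : I × ℕ+ → Module.End k V
  finiteDim : ∀ μ : P, Module.Finite k (weight μ)
  support_bounded : ∃ s : Finset P, ∀ μ : P, weight μ ≠ ⊥ →
    ∃ lam ∈ s, lam - μ ∈ AddSubmonoid.closure (Set.range alpha)
  f_weight : ∀ (i : I) (l : ℕ+) (μ : P),
    (weight μ).map (f (i, l)) ≤ weight (μ - (l : ℕ) • alpha i)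

namespace WeakLowerPerfectSpace

variable {k I P V : Type*} [Field k] [AddCommGroup P] [AddCommGroup V] [Module k V]

/-- `d il v` is the unique `n` with `v ∈ f_{il}^n V \ f_{il}^{n+1} V` (for `v ≠ 0`),
realized as the largest `n` with `v ∈ f_{il}^n V`. -/
noncomputable def d (S : WeakLowerPerfectSpace k I P V) (il : I × ℕ+) (v : V) : ℕ :=
  sSup {n : ℕ | v ∈ LinearMap.range (S.f il ^ n)}

end WeakLowerPerfectSpace

/-- A lower perfect basis `B` of a weak lower perfect space, with structure maps
`F il : B → B ∪ {0}` (extended by `F il 0 = 0`). -/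
structure LowerPerfectBasis {k I P V : Type*} [Field k] [AddCommGroup P]
    [AddCommGroup V] [Module k V] (S : WeakLowerPerfectSpace k I P V) (B : Set V) where
  indep : LinearIndependent k (fun b : B => (b : V))
  spans : Submodule.span k B = ⊤
  graded : ∀ b ∈ B, ∃ μ : P, b ∈ S.weight μ
  /-- the structure map `𝐟_{il}` -/
  F : I × ℕ+ → V → V
  F_zero : ∀ il : I × ℕ+, F il 0 = 0
  F_mem : ∀ il : I × ℕ+, ∀ b ∈ B, F il b ∈ B ∪ {0}
  F_approx : ∀ il : I × ℕ+, ∀ b ∈ B, ∃ c : kˣ,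
    S.f il b - (c : k) • F il b ∈ LinearMap.range (S.f il ^ (S.d il b + 2))
  F_inj : ∀ b ∈ B, ∀ b' ∈ B, (∀ il : I × ℕ+, F il b = F il b') → b = b'

namespace WeakLowerPerfectSpace

variable {k I P V : Type*} [Field k] [AddCommGroup P] [AddCommGroup V] [Module k V]

/-- The subspace `Σ_{(i,l) ∈ I^∞} f_{il} V`. -/
noncomputable def rad (S : WeakLowerPerfectSpace k I P V) : Submodule k V :=
  ⨆ il : I × ℕ+, LinearMap.range (S.f il)

/-- The highest core `B_H = {b ∈ B | d_{il}(b) = 0 for all (i,l) ∈ I^∞}`. -/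
def highestCore (S : WeakLowerPerfectSpace k I P V) (B : Set V) : Set V :=
  {b | b ∈ B ∧ ∀ il : I × ℕ+, S.d il b = 0}

end WeakLowerPerfectSpace

namespace WeakLowerPerfectSpace

variable {k I P V : Type*} [Field k] [AddCommGroup P] [AddCommGroup V] [Module k V]

/-- The projection onto the weight space `V_μ` along the other weight spaces. -/
theorem exists_proj (S : WeakLowerPerfectSpace k I P V) (μ : P) :
    ∃ π : Module.End k V, (∀ v ∈ S.weight μ, π v = v) ∧
      ∀ ν ≠ μ, ∀ v ∈ S.weight ν, π v = 0 := by
  have hc : IsCompl (S.weight μ) (⨆ (ν) (_ : ν ≠ μ), S.weight ν) := by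
    refine ⟨S.weight_indep μ, codisjoint_iff.2 (eq_top_iff.2 ?_)⟩
    rw [← S.weight_sup]
    refine iSup_le fun ν => ?_
    by_cases h : ν = μ
    · exact h ▸ le_sup_left
    · exact (le_iSup₂ (f := fun ν (_ : ν ≠ μ) => S.weight ν) ν h).trans le_sup_right
  refine ⟨Submodule.projection _ _ hc, fun v hv => ?_, fun ν hν v hv => ?_⟩
  · exact Submodule.projection_apply_left hc ⟨v, hv⟩
  · exact (Submodule.projection_apply_eq_zero_iff hc).2
      (le_iSup₂ (f := fun ν (_ : ν ≠ μ) => S.weight ν) ν hν hv)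

theorem f_pow_mem_weight (S : WeakLowerPerfectSpace k I P V) (i : I) (l : ℕ+) (N : ℕ) {ν : P}
    {v : V} (hv : v ∈ S.weight ν) :
    (S.f (i, l) ^ N) v ∈ S.weight (ν - (N * (l : ℕ)) • S.alpha i) := by
  induction N with
  | zero => simpa using hv
  | succ N ih =>
    have h := S.f_weight i l _ (Submodule.mem_map_of_mem ih)
    rw [pow_succ', Module.End.mul_apply]
    convert h using 2
    rw [add_mul, one_mul, add_smul, sub_sub]

theorem exists_bound_mem_closure (S : WeakLowerPerfectSpace k I P V) (i : I) (x : P) :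
    ∃ M : ℕ, ∀ n ≥ M, x - n • S.alpha i ∉ AddSubmonoid.closure (Set.range S.alpha) := by
  by_contra! h
  have hrep : ∀ y ∈ AddSubmonoid.closure (Set.range S.alpha),
      ∃ a : I →₀ ℤ, 0 ≤ a i ∧ Finsupp.linearCombination ℤ S.alpha a = y := by
    intro y hy
    induction hy using AddSubmonoid.closure_induction with
    | mem y hy =>
      obtain ⟨j, rfl⟩ := hy
      refine ⟨Finsupp.single j 1, ?_, by simp⟩
      classical
      rw [Finsupp.single_apply]
      split_ifs <;> norm_num
    | zero => exact ⟨0, by simp, by simp⟩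
    | add y z _ _ hy hz =>
      obtain ⟨a, ha, rfl⟩ := hy
      obtain ⟨b, hb, rfl⟩ := hz
      exact ⟨a + b, by simpa using add_nonneg ha hb, by simp⟩
  obtain ⟨n₀, -, h₀⟩ := h 0
  obtain ⟨a, -, ha⟩ := hrep _ h₀
  obtain ⟨n, hn, h₁⟩ := h (n₀ + (a i).toNat + 1)
  obtain ⟨b, hb, hb'⟩ := hrep _ h₁
  have key : a + Finsupp.single i (n₀ : ℤ) = b + Finsupp.single i (n : ℤ) := by
    apply S.alpha_indep
    simp [ha, hb']
  have := DFunLike.congr_fun key i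
  simp only [Finsupp.add_apply, Finsupp.single_eq_same] at this
  omega

theorem exists_weight_eq_bot (S : WeakLowerPerfectSpace k I P V) (i : I) (μ : P) :
    ∃ M : ℕ, ∀ n ≥ M, S.weight (μ + n • S.alpha i) = ⊥ := by
  obtain ⟨s, hs⟩ := S.support_bounded
  choose M hM using fun lam => S.exists_bound_mem_closure i (lam - μ)
  refine ⟨s.sup M, fun n hn => ?_⟩
  by_contra h
  obtain ⟨lam, hlam, hmem⟩ := hs _ h
  refine hM lam n ((Finset.le_sup hlam).trans hn) ?_
  rwa [sub_sub]

theorem exists_proj_f_pow_eq_zero (S : WeakLowerPerfectSpace k I P V) (il : I × ℕ+) (μ : P) :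
    ∃ π : Module.End k V, (∀ v ∈ S.weight μ, π v = v) ∧
      (∀ ν ≠ μ, ∀ v ∈ S.weight ν, π v = 0) ∧
      ∃ M : ℕ, ∀ n ≥ M, ∀ v, π ((S.f il ^ n) v) = 0 := by
  obtain ⟨i, l⟩ := il
  obtain ⟨π, h₁, h₀⟩ := S.exists_proj μ
  obtain ⟨M, hM⟩ := S.exists_weight_eq_bot i μ
  refine ⟨π, h₁, h₀, M, fun n hn v => ?_⟩
  have hv : v ∈ ⨆ ν, S.weight ν := S.weight_sup ▸ Submodule.mem_top
  induction hv using Submodule.iSup_induction' with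
  | zero => simp
  | add x y _ _ hx hy => rw [map_add, map_add, hx, hy, add_zero]
  | mem ν v hv =>
    have hw := S.f_pow_mem_weight i l n hv
    by_cases h : ν - (n * (l : ℕ)) • S.alpha i = μ
    · have hb := hM (n * l) (hn.trans (Nat.le_mul_of_pos_right n l.pos))
      rw [← h, sub_add_cancel] at hb
      rw [hb, Submodule.mem_bot] at hv
      simp [hv]
    · exact h₀ _ h _ hw

theorem range_f_pow_antitone (S : WeakLowerPerfectSpace k I P V) (il : I × ℕ+) :
    Antitone fun n => LinearMap.range (S.f il ^ n) := by
  refine antitone_nat_of_succ_le fun n => ?_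
  rw [pow_succ]
  exact LinearMap.range_comp_le_range _ _

theorem map_range_f_pow (S : WeakLowerPerfectSpace k I P V) (il : I × ℕ+) (n : ℕ) :
    (LinearMap.range (S.f il ^ n)).map (S.f il) = LinearMap.range (S.f il ^ (n + 1)) := by
  rw [pow_succ', Module.End.mul_eq_comp, LinearMap.range_comp]

theorem bddAbove_f_pow (S : WeakLowerPerfectSpace k I P V) (il : I × ℕ+) {μ : P} {v : V}
    (hv : v ∈ S.weight μ) (h0 : v ≠ 0) : BddAbove {n : ℕ | v ∈ LinearMap.range (S.f il ^ n)} := by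
  obtain ⟨π, h₁, -, M, hM⟩ := S.exists_proj_f_pow_eq_zero il μ
  refine ⟨M, fun n hn => ?_⟩
  by_contra! h
  obtain ⟨w, rfl⟩ := hn
  exact h0 ((h₁ _ hv).symm.trans (hM n h.le w))

end WeakLowerPerfectSpace

namespace LowerPerfectBasis

variable {k I P V : Type*} [Field k] [AddCommGroup P] [AddCommGroup V] [Module k V]
  {S : WeakLowerPerfectSpace k I P V} {B : Set V}

theorem le_d (LB : LowerPerfectBasis S B) {il : I × ℕ+} {n : ℕ} {b : V} (hb : b ∈ B)
    (hn : b ∈ LinearMap.range (S.f il ^ n)) : n ≤ S.d il b := by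
  obtain ⟨μ, hμ⟩ := LB.graded b hb
  exact le_csSup (S.bddAbove_f_pow il hμ (LB.indep.ne_zero ⟨b, hb⟩)) hn

theorem d_eq_zero_iff (LB : LowerPerfectBasis S B) {il : I × ℕ+} {b : V} (hb : b ∈ B) :
    S.d il b = 0 ↔ b ∉ LinearMap.range (S.f il) := by
  constructor
  · intro h hmem
    have := LB.le_d (n := 1) hb (by rwa [pow_one])
    omega
  · intro h
    refine Nat.le_zero.1 (csSup_le' fun n hn => ?_)
    by_contra! hpos
    refine h ?_
    simpa using S.range_f_pow_antitone il (show 1 ≤ n from hpos) hn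

theorem map_span_le (LB : LowerPerfectBasis S B) (il : I × ℕ+) (n : ℕ) :
    (Submodule.span k (B ∩ LinearMap.range (S.f il ^ n))).map (S.f il) ≤
      Submodule.span k (B ∩ LinearMap.range (S.f il ^ (n + 1))) ⊔
        LinearMap.range (S.f il ^ (n + 2)) := by
  rw [Submodule.map_span_le]
  rintro b ⟨hb, hn⟩
  obtain ⟨c, hc⟩ := LB.F_approx il b hb
  replace hc := S.range_f_pow_antitone il (Nat.add_le_add_right (LB.le_d hb hn) 2) hc
  have hFr : LB.F il b ∈ LinearMap.range (S.f il ^ (n + 1)) := by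
    have h₁ : S.f il b ∈ LinearMap.range (S.f il ^ (n + 1)) :=
      S.map_range_f_pow il n ▸ Submodule.mem_map_of_mem hn
    have h₂ := sub_mem h₁ (S.range_f_pow_antitone il (Nat.le_succ (n + 1)) hc)
    rw [sub_sub_cancel] at h₂
    exact (Submodule.smul_mem_iff _ c.ne_zero).1 h₂
  rw [← add_sub_cancel ((c : k) • LB.F il b) (S.f il b)]
  refine Submodule.add_mem_sup (Submodule.smul_mem _ _ ?_) hc
  rcases LB.F_mem il b hb with h | h
  · exact Submodule.subset_span ⟨h, hFr⟩
  · rw [Set.mem_singleton_iff.1 h]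
    exact zero_mem _

theorem range_f_pow_le_span_sup (LB : LowerPerfectBasis S B) (il : I × ℕ+) (n : ℕ) :
    LinearMap.range (S.f il ^ n) ≤ Submodule.span k (B ∩ LinearMap.range (S.f il ^ n)) ⊔
      LinearMap.range (S.f il ^ (n + 1)) := by
  induction n with
  | zero =>
    have : B ∩ (LinearMap.range (S.f il ^ 0) : Set V) = B := by
      simp [Module.End.one_eq_id]
    rw [this, LB.spans, top_sup_eq]
    exact le_top
  | succ n ih =>
    rw [← S.map_range_f_pow il n]
    refine (Submodule.map_mono ih).trans ?_
    rw [Submodule.map_sup, S.map_range_f_pow, S.map_range_f_pow]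
    exact sup_le (LB.map_span_le il n) le_sup_right

theorem range_f_pow_le_span_sup_add (LB : LowerPerfectBasis S B) (il : I × ℕ+) (n m : ℕ) :
    LinearMap.range (S.f il ^ n) ≤ Submodule.span k (B ∩ LinearMap.range (S.f il ^ n)) ⊔
      LinearMap.range (S.f il ^ (n + m)) := by
  induction m with
  | zero => exact le_sup_right
  | succ m ih =>
    refine ih.trans (sup_le le_sup_left ((LB.range_f_pow_le_span_sup il (n + m)).trans ?_))
    exact sup_le_sup_right (Submodule.span_mono (Set.inter_subset_inter_right _
      (S.range_f_pow_antitone il (Nat.le_add_right n m)))) _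

/-- Each `f_{il}^n V` is spanned by the elements of the perfect basis it contains. -/
theorem range_f_pow_le_span (LB : LowerPerfectBasis S B) (il : I × ℕ+) (n : ℕ) :
    LinearMap.range (S.f il ^ n) ≤ Submodule.span k (B ∩ LinearMap.range (S.f il ^ n)) := by
  suffices h : (⨆ ν, S.weight ν).map (S.f il ^ n) ≤
      Submodule.span k (B ∩ LinearMap.range (S.f il ^ n)) by
    rwa [S.weight_sup, ← LinearMap.range_eq_map] at h
  rw [Submodule.map_iSup]
  refine iSup_le fun ν => ?_
  rintro _ ⟨v, hv, rfl⟩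
  obtain ⟨i, l⟩ := il
  have hw := S.f_pow_mem_weight i l n hv
  obtain ⟨π, h₁, h₀, M, hM⟩ := S.exists_proj_f_pow_eq_zero (i, l) (ν - (n * (l : ℕ)) • S.alpha i)
  obtain ⟨y, hy, z, ⟨u, rfl⟩, hyz⟩ := Submodule.mem_sup.1
    (LB.range_f_pow_le_span_sup_add (i, l) n M (LinearMap.mem_range_self _ v))
  have hπ : (Submodule.span k (B ∩ LinearMap.range (S.f (i, l) ^ n))).map π ≤
      Submodule.span k (B ∩ LinearMap.range (S.f (i, l) ^ n)) := by
    rw [Submodule.map_span_le]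
    rintro b hb
    obtain ⟨μ, hμ⟩ := LB.graded b hb.1
    by_cases h : μ = ν - (n * (l : ℕ)) • S.alpha i
    · rw [h₁ b (h ▸ hμ)]
      exact Submodule.subset_span hb
    · rw [h₀ μ h b hμ]
      exact zero_mem _
  have hx := h₁ _ hw
  rw [← hyz, map_add, hM _ (Nat.le_add_left M n), add_zero, hyz] at hx
  rw [← hx]
  exact hπ (Submodule.mem_map_of_mem hy)

theorem rad_eq_span (LB : LowerPerfectBasis S B) :
    S.rad = Submodule.span k (B \ S.highestCore B) := by
  have hmem : ∀ b ∈ B, b ∉ S.highestCore B ↔ ∃ il, b ∈ LinearMap.range (S.f il) := by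
    intro b hb
    simp [WeakLowerPerfectSpace.highestCore, hb, LB.d_eq_zero_iff hb]
  apply le_antisymm
  · refine iSup_le fun il => ?_
    have h := LB.range_f_pow_le_span il 1
    rw [pow_one] at h
    exact h.trans (Submodule.span_mono fun b hb => ⟨hb.1, (hmem b hb.1).2 ⟨il, hb.2⟩⟩)
  · rw [Submodule.span_le]
    rintro b ⟨hb, hb'⟩
    obtain ⟨il, h⟩ := (hmem b hb).1 hb'
    exact (le_iSup (fun il => LinearMap.range (S.f il)) il) h

end LowerPerfectBasis

theorem stmt_13 {k I P V : Type*} [Field k] [AddCommGroup P] [AddCommGroup V] [Module k V]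
    (S : WeakLowerPerfectSpace k I P V) (B : Set V) (LB : LowerPerfectBasis S B) :
    LinearIndependent k
      (fun x : ↥(⇑S.rad.mkQ '' S.highestCore B) => (x : V ⧸ S.rad)) ∧
    Submodule.span k (⇑S.rad.mkQ '' S.highestCore B) = ⊤ := by
  have hsub : S.highestCore B ⊆ B := fun b hb => hb.1
  have hB : (B \ S.highestCore B) ∪ S.highestCore B = B := Set.sdiff_union_of_subset hsub
  constructor
  · have hind : LinearIndepOn k id ((B \ S.highestCore B) ∪ S.highestCore B) := by
      rw [hB]
      exact LB.indep
    have h := ((linearIndepOn_union_iff_quotient Set.disjoint_sdiff_left).1 hind).2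
    rw [Set.image_id, ← LB.rad_eq_span] at h
    exact h.id_image
  · have hspan : S.rad ⊔ Submodule.span k (S.highestCore B) = ⊤ := by
      rw [LB.rad_eq_span, ← Submodule.span_union, hB, LB.spans]
    rw [← Submodule.map_span, ← S.rad.range_mkQ, LinearMap.range_eq_map, ← hspan,
      Submodule.map_sup, Submodule.mkQ_map_self, bot_sup_eq]
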